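/- Let R > 0, B = B(0,R) ⊂ ℝⁿ, 1 < p < ∞, and let f ∈ L¹_loc(B) satisfy L := liminf_{s→1⁻} (1−s) ∫_B∫_B |f(x)−f(y)|ᵖ / |x−y|^{n+sp} dy dx < ∞. Then f belongs to W^{1,p}_loc(B): f has a weak gradient ∇f ∈ Lᵖ(B) and ∫_B |∇f|ᵖ ≤ C·L for a constant C depending only on n and p. -/

import Mathlib

open MeasureTheory Metric Set Filter
open scoped RealInnerProductSpace ENNReal

section WeakCompactness

variable {α : Type*} [MeasurableSpace α] {μ : Measure α} {p q : ℝ}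

/-- Hölder's inequality for the extended norm of an integral of a product. -/
lemma enorm_integral_mul_le (hpq : p.HolderConjugate q) {φ G : α → ℝ}
    (hφ : AEMeasurable φ μ) (hG : AEMeasurable G μ) :
    ‖∫ x, φ x * G x ∂μ‖ₑ ≤
      (∫⁻ x, ‖G x‖ₑ ^ p ∂μ) ^ (1 / p) * (∫⁻ x, ‖φ x‖ₑ ^ q ∂μ) ^ (1 / q) := by
  calc ‖∫ x, φ x * G x ∂μ‖ₑ ≤ ∫⁻ x, ‖φ x * G x‖ₑ ∂μ := enorm_integral_le_lintegral_enorm _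
    _ = ∫⁻ x, ((fun x => ‖G x‖ₑ) * fun x => ‖φ x‖ₑ) x ∂μ := by
        refine lintegral_congr fun x => ?_
        simp [enorm_mul, mul_comm]
    _ ≤ _ := ENNReal.lintegral_mul_le_Lp_mul_Lq μ hpq hG.enorm hφ.enorm

lemma lintegral_enorm_rpow_ne_top_of_bounded [IsFiniteMeasure μ] (hq : 0 ≤ q) {φ : α → ℝ} {K : ℝ}
    (hK : ∀ x, |φ x| ≤ K) : ∫⁻ x, ‖φ x‖ₑ ^ q ∂μ ≠ ⊤ := by
  refine ne_top_of_le_ne_top (b := ENNReal.ofReal K ^ q * μ univ) ?_ ?_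
  · exact ENNReal.mul_ne_top (ENNReal.rpow_ne_top_of_nonneg hq ENNReal.ofReal_ne_top)
      (measure_ne_top _ _)
  · rw [← lintegral_const]
    refine lintegral_mono fun x => ENNReal.rpow_le_rpow ?_ hq
    rw [Real.enorm_eq_ofReal_abs]
    exact ENNReal.ofReal_le_ofReal (hK x)

lemma memLp_of_lintegral_enorm_rpow_ne_top (hp : 0 < p) {G : α → ℝ} (hG : Measurable G)
    (h : ∫⁻ x, ‖G x‖ₑ ^ p ∂μ ≠ ⊤) : MemLp G (ENNReal.ofReal p) μ := by
  refine ⟨hG.aestronglyMeasurable, ?_⟩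
  rw [eLpNorm_lt_top_iff_lintegral_rpow_enorm_lt_top (by simpa using hp) ENNReal.ofReal_ne_top,
    ENNReal.toReal_ofReal hp.le]
  exact h.lt_top

lemma integrable_of_lintegral_enorm_rpow_ne_top [IsFiniteMeasure μ] (hp : 1 < p) {G : α → ℝ}
    (hG : Measurable G) (h : ∫⁻ x, ‖G x‖ₑ ^ p ∂μ ≠ ⊤) : Integrable G μ :=
  (memLp_of_lintegral_enorm_rpow_ne_top (by linarith) hG h).integrable (by simpa using hp.le)

/-- Along an ultrafilter, a sequence bounded in `Lᵖ` has its set integrals converging to those of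
an integrable function. -/
lemma exists_tendsto_setIntegral_of_lp_bounded [IsFiniteMeasure μ] (hp : 1 < p)
    (U : Ultrafilter ℕ) {G : ℕ → α → ℝ} (hG : ∀ k, Measurable (G k)) {K : ℝ≥0∞} (hK : K ≠ ⊤)
    (hb : ∀ k, ∫⁻ x, ‖G k x‖ₑ ^ p ∂μ ≤ K) :
    ∃ g : α → ℝ, Measurable g ∧ Integrable g μ ∧
      ∀ A, MeasurableSet A → Tendsto (fun k => ∫ x in A, G k x ∂μ) U (nhds (∫ x in A, g x ∂μ)) := by
  classical
  have hpq : p.HolderConjugate p.conjExponent := .conjExponent hp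
  set q := p.conjExponent
  have hq0 : 0 < q := hpq.symm.pos
  have hint : ∀ k, Integrable (G k) μ := fun k =>
    integrable_of_lintegral_enorm_rpow_ne_top hp (hG k) (ne_top_of_le_ne_top hK (hb k))
  have hbound : ∀ A, MeasurableSet A → ∀ k,
      ‖∫ x in A, G k x ∂μ‖ₑ ≤ K ^ (1 / p) * μ A ^ (1 / q) := by
    intro A hA k
    have h1 : ∫ x in A, G k x ∂μ = ∫ x, A.indicator (fun _ => (1 : ℝ)) x * G k x ∂μ := by
      rw [← integral_indicator hA]
      refine integral_congr_ae (.of_forall fun x => ?_)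
      by_cases hx : x ∈ A <;> simp [hx]
    have h2 : ∫⁻ x, ‖A.indicator (fun _ => (1 : ℝ)) x‖ₑ ^ q ∂μ = μ A := by
      rw [← lintegral_indicator_one hA]
      refine lintegral_congr fun x => ?_
      by_cases hx : x ∈ A <;> simp [hx, hq0]
    rw [h1]
    refine (enorm_integral_mul_le hpq (measurable_const.indicator hA).aemeasurable
      (hG k).aemeasurable).trans ?_
    rw [h2]
    gcongr
    exact hb k
  have hK' : K ^ (1 / p) ≠ ⊤ := ENNReal.rpow_ne_top_of_nonneg (by positivity) hK
  have hex : ∀ A, ∃ l, MeasurableSet A → Tendsto (fun k => ∫ x in A, G k x ∂μ) U (nhds l) := by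
    intro A
    by_cases hA : MeasurableSet A
    · have hfin : K ^ (1 / p) * μ A ^ (1 / q) ≠ ⊤ :=
        ENNReal.mul_ne_top hK' (ENNReal.rpow_ne_top_of_nonneg (by positivity) (measure_ne_top _ _))
      have hc : IsCompact (closedBall (0 : ℝ) (K ^ (1 / p) * μ A ^ (1 / q)).toReal) :=
        isCompact_closedBall _ _
      obtain ⟨l, -, hl⟩ := hc.ultrafilter_le_nhds' (U.map fun k => ∫ x in A, G k x ∂μ) (by
        rw [Ultrafilter.mem_map]
        refine Filter.univ_mem' fun k => ?_
        simp only [mem_preimage, mem_closedBall_zero_iff]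
        rw [← toReal_enorm]
        exact ENNReal.toReal_mono hfin (hbound A hA k))
      exact ⟨l, fun _ => hl⟩
    · exact ⟨0, fun h => absurd h hA⟩
  choose ν hν using hex
  have hνle : ∀ A, MeasurableSet A → ‖ν A‖ₑ ≤ K ^ (1 / p) * μ A ^ (1 / q) := fun A hA =>
    le_of_tendsto' (hν A hA).enorm (hbound A hA)
  have hνunion : ∀ A B, MeasurableSet A → MeasurableSet B → Disjoint A B →
      ν (A ∪ B) = ν A + ν B := by
    intro A B hA hB hAB
    refine tendsto_nhds_unique (hν _ (hA.union hB)) ?_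
    simpa only [setIntegral_union hAB hB (hint _).integrableOn (hint _).integrableOn]
      using (hν A hA).add (hν B hB)
  have hν0 : ν ∅ = 0 := by simpa [hq0] using hνle ∅ .empty
  let V : SignedMeasure α :=
    { measureOf' := fun A => if MeasurableSet A then ν A else 0
      empty' := by simp [hν0]
      not_measurable' := fun A hA => by simp [hA]
      m_iUnion' := by
        intro A hA hdisj
        simp only [hA, MeasurableSet.iUnion hA, if_true]
        have hfinset : ∀ s : Finset ℕ, ν (⋃ i ∈ s, A i) = ∑ i ∈ s, ν (A i) := by
          intro s
          induction s using Finset.induction_on with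
          | empty => simpa using hν0
          | insert a s ha ih =>
            rw [Finset.set_biUnion_insert, hνunion _ _ (hA a) (s.measurableSet_biUnion
              fun i _ => hA i), ih, Finset.sum_insert ha]
            simp only [disjoint_iUnion_right]
            exact fun i hi => hdisj (by rintro rfl; exact ha hi)
        have hdiff : ∀ s : Finset ℕ, ‖∑ i ∈ s, ν (A i) - ν (⋃ i, A i)‖ₑ ≤
            K ^ (1 / p) * (μ (⋃ i, A i) - ∑ i ∈ s, μ (A i)) ^ (1 / q) := by
          intro s
          have hsm : MeasurableSet (⋃ i ∈ s, A i) := s.measurableSet_biUnion fun i _ => hA i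
          have hsub : (⋃ i ∈ s, A i) ⊆ ⋃ i, A i := iUnion₂_subset_iUnion _ _
          have hd : MeasurableSet ((⋃ i, A i) \ ⋃ i ∈ s, A i) := (MeasurableSet.iUnion hA).diff hsm
          have h1 := hνunion _ _ hsm hd disjoint_sdiff_right
          rw [union_sdiff_cancel hsub, hfinset] at h1
          rw [h1, sub_add_cancel_left, enorm_neg]
          refine (hνle _ hd).trans_eq ?_
          rw [measure_sdiff hsub hsm.nullMeasurableSet (measure_ne_top _ _),
            measure_biUnion_finset (fun i _ j _ hij => hdisj hij) fun i _ => hA i]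
        rw [HasSum, tendsto_iff_edist_tendsto_0]
        simp only [edist_eq_enorm_sub]
        refine tendsto_of_tendsto_of_tendsto_of_le_of_le tendsto_const_nhds ?_ (fun _ => zero_le)
          hdiff
        have h1 : Tendsto (fun s : Finset ℕ => μ (⋃ i, A i) - ∑ i ∈ s, μ (A i)) atTop (nhds 0) := by
          have h2 : HasSum (fun i => μ (A i)) (μ (⋃ i, A i)) := by
            rw [measure_iUnion hdisj hA]; exact ENNReal.summable.hasSum
          have h3 := ENNReal.Tendsto.sub (tendsto_const_nhds (x := μ (⋃ i, A i))) h2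
            (Or.inl (measure_ne_top _ _))
          rwa [tsub_self] at h3
        have h4 := (ENNReal.continuous_rpow_const (y := 1 / q)).tendsto 0 |>.comp h1
        have h5 := ENNReal.Tendsto.const_mul h4 (Or.inr hK')
        simpa [hq0] using h5 }
  have hV : ∀ A, MeasurableSet A → V A = ν A := fun A hA => if_pos hA
  have hac : V ≪ᵥ μ.toENNRealVectorMeasure := by
    refine VectorMeasure.AbsolutelyContinuous.mk fun A hA h0 => ?_
    rw [Measure.toENNRealVectorMeasure_apply_measurable hA] at h0
    rw [hV A hA]
    simpa [h0, hq0] using hνle A hA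
  refine ⟨V.rnDeriv μ, V.measurable_rnDeriv μ, V.integrable_rnDeriv μ, fun A hA => ?_⟩
  rw [← withDensityᵥ_apply (V.integrable_rnDeriv μ) hA, V.withDensityᵥ_rnDeriv_eq μ hac, hV A hA]
  exact hν A hA

/-- Weak sequential compactness in `Lᵖ`, `1 < p`, over a finite measure space: limits of pairings
with bounded functions are represented by a single function, whose norm is controlled by the limit
of the bounds. -/
theorem exists_weak_limit_of_lp_bounded [IsFiniteMeasure μ] (hp : 1 < p) {G : ℕ → α → ℝ}
    (hG : ∀ k, Measurable (G k)) {K M : ℝ≥0∞} (hK : K ≠ ⊤) {m : ℕ → ℝ≥0∞}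
    (hmK : ∀ k, m k ≤ K) (hm : Tendsto m atTop (nhds M))
    (hb : ∀ k, ∫⁻ x, ‖G k x‖ₑ ^ p ∂μ ≤ m k) :
    ∃ g : α → ℝ, Measurable g ∧ ∫⁻ x, ‖g x‖ₑ ^ p ∂μ ≤ M ∧
      ∀ φ : α → ℝ, Measurable φ → ∀ C, (∀ x, |φ x| ≤ C) → ∀ l,
        Tendsto (fun k => ∫ x, φ x * G k x ∂μ) atTop (nhds l) → ∫ x, φ x * g x ∂μ = l := by
  have hpq : p.HolderConjugate p.conjExponent := .conjExponent hp
  set q := p.conjExponent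
  have hq0 : 0 < q := hpq.symm.pos
  have hp0 : 0 < p := hpq.pos
  have hM : M ≠ ⊤ := ne_top_of_le_ne_top hK (le_of_tendsto' hm hmK)
  set U : Ultrafilter ℕ := hyperfilter ℕ
  have hU : (U : Filter ℕ) ≤ atTop := Nat.hyperfilter_le_atTop
  have hint : ∀ k, Integrable (G k) μ := fun k => integrable_of_lintegral_enorm_rpow_ne_top hp
    (hG k) (ne_top_of_le_ne_top hK ((hb k).trans (hmK k)))
  obtain ⟨g, hgm, hgi, hg⟩ := exists_tendsto_setIntegral_of_lp_bounded hp U hG hK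
    fun k => (hb k).trans (hmK k)
  have hsimple : ∀ s : SimpleFunc α ℝ,
      Tendsto (fun k => ∫ x, s x * G k x ∂μ) U (nhds (∫ x, s x * g x ∂μ)) := by
    intro s
    have hsi : ∀ (t : SimpleFunc α ℝ) {u : α → ℝ}, Integrable u μ →
        Integrable (fun x => t x * u x) μ := by
      intro t u hu
      obtain ⟨C, hC⟩ := t.exists_forall_norm_le
      exact hu.bdd_mul t.aestronglyMeasurable (.of_forall hC)
    induction s using SimpleFunc.induction with
    | const c hs =>
      rename_i A
      have key : ∀ u : α → ℝ, ∫ x, (SimpleFunc.piecewise A hs (SimpleFunc.const α c)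
          (SimpleFunc.const α 0)) x * u x ∂μ = c * ∫ x in A, u x ∂μ := by
        intro u
        rw [← integral_const_mul, ← integral_indicator hs]
        refine integral_congr_ae (.of_forall fun x => ?_)
        by_cases hx : x ∈ A <;> simp [hx]
      simp only [key]
      exact (hg A hs).const_mul c
    | add hd hs ht =>
      simp only [SimpleFunc.coe_add, Pi.add_apply, add_mul]
      simp only [integral_add (hsi _ (hint _)) (hsi _ (hint _)),
        integral_add (hsi _ hgi) (hsi _ hgi)]
      exact hs.add ht
  have hsb : ∀ s : SimpleFunc α ℝ, ∫⁻ x, ‖s x‖ₑ ^ q ∂μ ≠ ⊤ := by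
    intro s
    obtain ⟨C, hC⟩ := s.exists_forall_norm_le
    exact lintegral_enorm_rpow_ne_top_of_bounded hq0.le hC
  have hsle : ∀ s : SimpleFunc α ℝ,
      ‖∫ x, s x * g x ∂μ‖ₑ ≤ M ^ (1 / p) * (∫⁻ x, ‖s x‖ₑ ^ q ∂μ) ^ (1 / q) := by
    intro s
    have h1 : Tendsto (fun k => m k ^ (1 / p) * (∫⁻ x, ‖s x‖ₑ ^ q ∂μ) ^ (1 / q)) U
        (nhds (M ^ (1 / p) * (∫⁻ x, ‖s x‖ₑ ^ q ∂μ) ^ (1 / q))) :=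
      ENNReal.Tendsto.mul_const
        (((ENNReal.continuous_rpow_const (y := 1 / p)).tendsto M).comp (hm.mono_left hU))
        (Or.inr (ENNReal.rpow_ne_top_of_nonneg (by positivity) (hsb s)))
    refine le_of_tendsto_of_tendsto' (hsimple s).enorm h1 fun k => ?_
    refine (enorm_integral_mul_le hpq s.measurable.aemeasurable (hG k).aemeasurable).trans ?_
    gcongr
    exact hb k
  have hgM : ∫⁻ x, ‖g x‖ₑ ^ p ∂μ ≤ M := by
    rw [lintegral_eq_nnreal]
    refine iSup₂_le fun t ht => ?_
    have hA : MeasurableSet {x | 0 ≤ g x} := measurableSet_le measurable_const hgm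
    set s : SimpleFunc α ℝ := (t.map fun a : NNReal => (a : ℝ) ^ (1 / q)) *
      SimpleFunc.piecewise {x | 0 ≤ g x} hA (SimpleFunc.const α 1) (SimpleFunc.const α (-1)) with hs
    have hsg : ∀ x, s x * g x = (t x : ℝ) ^ (1 / q) * |g x| := by
      intro x
      by_cases hx : 0 ≤ g x
      · simp [hs, hx, abs_of_nonneg hx]
      · simp [hs, hx, abs_of_neg (not_le.1 hx)]
    have hsn : ∀ x, ‖s x‖ₑ ^ q = t x := by
      intro x
      have : |s x| = (t x : ℝ) ^ (1 / q) := by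
        by_cases hx : 0 ≤ g x
        · simp [hs, hx, abs_of_nonneg, Real.rpow_nonneg]
        · simp [hs, hx, abs_of_nonneg, Real.rpow_nonneg]
      rw [Real.enorm_eq_ofReal_abs, this, ENNReal.ofReal_rpow_of_nonneg (by positivity) hq0.le,
        ← Real.rpow_mul (by positivity), one_div_mul_cancel hq0.ne', Real.rpow_one,
        ENNReal.ofReal_coe_nnreal]
    have hlow : ∀ x, (t x : ℝ≥0∞) ≤ ENNReal.ofReal (s x * g x) := by
      intro x
      have h1 : (t x : ℝ≥0∞) ≤ ‖g x‖ₑ ^ p := ht x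
      rw [Real.enorm_eq_ofReal_abs, ENNReal.ofReal_rpow_of_nonneg (abs_nonneg _) hp0.le,
        ← ENNReal.ofReal_coe_nnreal, ENNReal.ofReal_le_ofReal_iff (by positivity)] at h1
      rw [hsg, ← ENNReal.ofReal_coe_nnreal]
      refine ENNReal.ofReal_le_ofReal ?_
      have h2 : (t x : ℝ) ^ (1 / p) ≤ |g x| := by
        rw [one_div, Real.rpow_inv_le_iff_of_pos (by positivity) (by positivity) hp0]
        exact h1
      calc (t x : ℝ) = (t x : ℝ) ^ (1 / q) * (t x : ℝ) ^ (1 / p) := by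
            rw [← Real.rpow_add' (by positivity), add_comm, one_div, one_div,
              hpq.inv_add_inv_eq_one, Real.rpow_one]
            rw [add_comm, one_div, one_div, hpq.inv_add_inv_eq_one]; exact one_ne_zero
        _ ≤ _ := by gcongr
    have hI : (t.map ((↑) : NNReal → ℝ≥0∞)).lintegral μ = ∫⁻ x, t x ∂μ := by
      rw [← SimpleFunc.lintegral_eq_lintegral]; rfl
    rw [hI]
    set I := ∫⁻ x, (t x : ℝ≥0∞) ∂μ
    have hIle : I ≤ M ^ (1 / p) * I ^ (1 / q) := by
      have h1 := hsle s
      simp only [hsn] at h1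
      refine le_trans ?_ h1
      obtain ⟨C, hC⟩ := s.exists_forall_norm_le
      have h0 : ∀ x, 0 ≤ s x * g x := fun x => by rw [hsg]; positivity
      rw [Real.enorm_of_nonneg (integral_nonneg h0), ofReal_integral_eq_lintegral_ofReal
        (hgi.bdd_mul s.aestronglyMeasurable (.of_forall hC)) (.of_forall h0)]
      exact lintegral_mono hlow
    have hIfin : I ≠ ⊤ := by
      have := hsb s
      simp only [hsn] at this
      exact this
    rcases eq_or_ne I 0 with h0 | h0
    · rw [h0]; exact zero_le
    · have hIq0 : I ^ (1 / q) ≠ 0 := by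
        simp [ENNReal.rpow_eq_zero_iff, h0, hIfin]
      have hIqt : I ^ (1 / q) ≠ ⊤ := ENNReal.rpow_ne_top_of_nonneg (by positivity) hIfin
      have h1 : I ^ (1 / p) * I ^ (1 / q) ≤ M ^ (1 / p) * I ^ (1 / q) := by
        rwa [← ENNReal.rpow_add _ _ h0 hIfin, one_div, one_div, hpq.inv_add_inv_eq_one,
          ENNReal.rpow_one, ← one_div, ← one_div]
      have h2 := (ENNReal.mul_le_mul_iff_left hIq0 hIqt).1 h1
      exact (ENNReal.rpow_le_rpow_iff (by positivity)).1 h2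
  refine ⟨g, hgm, hgM, fun φ hφ C hC l hl => ?_⟩
  have hφq := lintegral_enorm_rpow_ne_top_of_bounded (μ := μ) hq0.le hC
  have hφL := memLp_of_lintegral_enorm_rpow_ne_top hq0 hφ hφq
  have hφi : ∀ {u : α → ℝ}, Integrable u μ → Integrable (fun x => φ x * u x) μ := fun hu =>
    hu.bdd_mul hφ.aestronglyMeasurable (.of_forall hC)
  rw [← edist_eq_zero]
  have hKp : K ^ (1 / p) ≠ ⊤ := ENNReal.rpow_ne_top_of_nonneg (by positivity) hK
  have key : ∀ ε : ℝ≥0∞, ε ≠ 0 →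
      edist (∫ x, φ x * g x ∂μ) l ≤ K ^ (1 / p) * ε + K ^ (1 / p) * ε := by
    intro ε hε
    obtain ⟨s, hs, -⟩ := hφL.exists_simpleFunc_eLpNorm_sub_lt ENNReal.ofReal_ne_top hε
    rw [eLpNorm_eq_lintegral_rpow_enorm_toReal (by simpa using hq0) ENNReal.ofReal_ne_top,
      ENNReal.toReal_ofReal hq0.le] at hs
    have hdist : ∀ u : α → ℝ, Measurable u → Integrable u μ → ∫⁻ x, ‖u x‖ₑ ^ p ∂μ ≤ K →
        edist (∫ x, φ x * u x ∂μ) (∫ x, s x * u x ∂μ) ≤ K ^ (1 / p) * ε := by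
      intro u hum hui huK
      obtain ⟨D, hD⟩ := s.exists_forall_norm_le
      rw [edist_eq_enorm_sub, ← integral_sub (hφi hui)
        (hui.bdd_mul s.aestronglyMeasurable (.of_forall hD))]
      simp only [← sub_mul]
      refine (enorm_integral_mul_le hpq (φ := fun x => φ x - s x)
        (hφ.sub s.measurable).aemeasurable hum.aemeasurable).trans ?_
      gcongr
      exact hs.le
    refine (edist_triangle _ (∫ x, s x * g x ∂μ) _).trans (add_le_add
      (hdist g hgm hgi (hgM.trans (le_of_tendsto' hm hmK))) ?_)
    refine le_of_tendsto' ((hsimple s).edist (hl.mono_left hU)) fun k => ?_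
    rw [edist_comm]
    exact hdist _ (hG k) (hint k) ((hb k).trans (hmK k))
  have hlim : Tendsto (fun j : ℕ => K ^ (1 / p) * (j : ℝ≥0∞)⁻¹ + K ^ (1 / p) * (j : ℝ≥0∞)⁻¹) atTop
      (nhds 0) := by
    have h := ENNReal.Tendsto.const_mul (a := K ^ (1 / p)) ENNReal.tendsto_inv_nat_nhds_zero
      (Or.inr hKp)
    simpa using h.add h
  exact le_antisymm (ge_of_tendsto' hlim fun j => key _ (by simp)) zero_le

end WeakCompactness

section RadialKernel

variable {E : Type*} [NormedAddCommGroup E] [InnerProductSpace ℝ E]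

/-- A bounded, nonnegative, measurable radial profile supported in `[0, δ)`. -/
structure IsRadialWeight (w : ℝ → ℝ) (δ : ℝ) : Prop where
  measurable : Measurable w
  nonneg : ∀ r, 0 ≤ w r
  bounded : ∃ W, ∀ r, w r ≤ W
  eq_zero : ∀ r, δ ≤ r → w r = 0

/-- The second moment of a radial weight. -/
noncomputable def secondMoment (E : Type*) [NormedAddCommGroup E] [MeasureSpace E] (w : ℝ → ℝ) : ℝ :=
  ∫ h : E, ‖h‖ ^ 2 * w ‖h‖

/-- The odd kernel in direction `e` attached to a radial profile. -/
noncomputable def dirKernel (w : ℝ → ℝ) (e h : E) : ℝ := ⟪e, h⟫ * w ‖h‖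

variable {w : ℝ → ℝ} {δ : ℝ}

lemma dirKernel_neg (w : ℝ → ℝ) (e h : E) : dirKernel w e (-h) = -dirKernel w e h := by
  simp [dirKernel, inner_neg_right]

lemma IsRadialWeight.abs_dirKernel_le (hw : IsRadialWeight w δ) {e : E} (he : ‖e‖ = 1) (h : E) :
    |dirKernel w e h| ≤ ‖h‖ * w ‖h‖ := by
  rw [dirKernel, abs_mul, abs_of_nonneg (hw.nonneg _)]
  refine mul_le_mul_of_nonneg_right ?_ (hw.nonneg _)
  simpa [he] using abs_real_inner_le_norm e h

lemma IsRadialWeight.dirKernel_eq_zero (hw : IsRadialWeight w δ) (e : E) {h : E} (hh : δ ≤ ‖h‖) :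
    dirKernel w e h = 0 := by
  simp [dirKernel, hw.eq_zero _ hh]

lemma IsRadialWeight.exists_dirKernel_bound (hw : IsRadialWeight w δ) {e : E} (he : ‖e‖ = 1) :
    ∃ C, ∀ h, ‖dirKernel w e h‖ ≤ C := by
  obtain ⟨W, hW⟩ := hw.bounded
  refine ⟨|δ| * W, fun h => ?_⟩
  have hW0 : 0 ≤ W := (hw.nonneg 0).trans (hW 0)
  rcases le_or_gt δ ‖h‖ with hh | hh
  · rw [hw.dirKernel_eq_zero e hh, norm_zero]; positivity
  · refine (hw.abs_dirKernel_le he h).trans ?_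
    gcongr
    · exact hw.nonneg _
    · exact hh.le.trans (le_abs_self δ)
    · exact hW _

variable [FiniteDimensional ℝ E] [MeasurableSpace E] [BorelSpace E]

/-- The nonlocal directional difference quotient of `f` on `B` with radial profile `w`. -/
noncomputable def nonlocalDeriv (w : ℝ → ℝ) (e : E) (B : Set E) (f : E → ℝ) (x : E) : ℝ :=
  (secondMoment E w / Module.finrank ℝ E)⁻¹ * ∫ y in B, (f y - f x) * dirKernel w e (x - y)

lemma IsRadialWeight.integrable_mul (hw : IsRadialWeight w δ) {ψ : E → ℝ} (hψ : Continuous ψ) :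
    Integrable (fun h : E => ψ h * w ‖h‖) := by
  obtain ⟨W, hW⟩ := hw.bounded
  have h1 : Integrable ((closedBall (0 : E) δ).indicator ψ) :=
    (hψ.continuousOn.integrableOn_compact (isCompact_closedBall _ _)).integrable_indicator
      measurableSet_closedBall
  refine (h1.mul_bdd (c := W) (hw.measurable.comp measurable_norm).aestronglyMeasurable
    (.of_forall fun h => ?_)).congr (.of_forall fun h => ?_)
  · rw [Function.comp_apply, Real.norm_of_nonneg (hw.nonneg _)]; exact hW _
  · by_cases hh : h ∈ closedBall (0 : E) δ
    · simp [indicator_of_mem hh]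
    · have : δ ≤ ‖h‖ := by
        rw [mem_closedBall_zero_iff, not_le] at hh; exact hh.le
      simp [hw.eq_zero _ this]

lemma integral_inner_sq_mul_radial_eq {u v : E} (huv : ‖u‖ = ‖v‖) (w : ℝ → ℝ) :
    ∫ h : E, ⟪u, h⟫ ^ 2 * w ‖h‖ = ∫ h : E, ⟪v, h⟫ ^ 2 * w ‖h‖ := by
  set T : E ≃ₗᵢ[ℝ] E := (ℝ ∙ (u - v))ᗮ.reflection
  have hT : T u = v := Submodule.reflection_sub huv
  rw [← T.measurePreserving.integral_comp T.toHomeomorph.measurableEmbedding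
    (fun h => ⟪v, h⟫ ^ 2 * w ‖h‖)]
  refine integral_congr_ae (.of_forall fun h => ?_)
  simp only [LinearIsometryEquiv.norm_map]
  rw [← hT, LinearIsometryEquiv.inner_map_map]

/-- A radial weight has isotropic second moments. -/
lemma IsRadialWeight.integral_inner_mul_inner (hw : IsRadialWeight w δ) (u v : E) :
    Module.finrank ℝ E * ∫ h : E, ⟪u, h⟫ * ⟪v, h⟫ * w ‖h‖ = ⟪u, v⟫ * secondMoment E w := by
  set Q : E → ℝ := fun a => ∫ h : E, ⟪a, h⟫ ^ 2 * w ‖h‖ with hQ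
  have hi : ∀ a b : E, Integrable fun h : E => ⟪a, h⟫ * ⟪b, h⟫ * w ‖h‖ := fun a b =>
    hw.integrable_mul (ψ := fun h => ⟪a, h⟫ * ⟪b, h⟫) (by fun_prop)
  have hi2 : ∀ a : E, Integrable fun h : E => ⟪a, h⟫ ^ 2 * w ‖h‖ := fun a =>
    hw.integrable_mul (ψ := fun h => ⟪a, h⟫ ^ 2) (by fun_prop)
  have hQd : ∀ a : E, Module.finrank ℝ E * Q a = ‖a‖ ^ 2 * secondMoment E w := by
    intro a
    let b := stdOrthonormalBasis ℝ E
    have h1 : ∀ i, ‖a‖ ^ 2 * Q (b i) = Q a := by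
      intro i
      have h2 : Q (‖a‖ • b i) = Q a :=
        integral_inner_sq_mul_radial_eq (by simp [norm_smul, b.norm_eq_one]) w
      rw [← h2, hQ]
      simp only
      rw [← integral_const_mul]
      refine integral_congr_ae (.of_forall fun h => ?_)
      simp only [inner_smul_left]
      simp
      ring
    have h3 : secondMoment E w = ∑ i, Q (b i) := by
      rw [secondMoment, hQ, ← integral_finsetSum _ fun i _ => hi2 _]
      refine integral_congr_ae (.of_forall fun h => ?_)
      simp only
      rw [← Finset.sum_mul, ← b.sum_sq_norm_inner_right h]
      simp
    rw [h3, Finset.mul_sum]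
    simp [h1]
  have hpol : ∫ h : E, ⟪u, h⟫ * ⟪v, h⟫ * w ‖h‖ = (Q (u + v) - Q u - Q v) / 2 := by
    rw [hQ]
    simp only
    rw [← integral_sub (hi2 _) (hi2 _), ← integral_sub (by exact (hi2 _).sub (hi2 _)) (hi2 _),
      ← integral_div]
    refine integral_congr_ae (.of_forall fun h => ?_)
    simp only [inner_add_left]
    ring
  have h1 := hQd (u + v)
  have h2 := hQd u
  have h3 := hQd v
  rw [norm_add_sq_real] at h1
  rw [hpol]
  linear_combination (h1 - h2 - h3) / 2

lemma integral_dirKernel (w : ℝ → ℝ) (e : E) : ∫ h : E, dirKernel w e h = 0 := by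
  have h := integral_neg_eq_self (dirKernel w e) volume
  simp only [dirKernel_neg, integral_neg] at h
  linarith

lemma IsRadialWeight.measurable_dirKernel (hw : IsRadialWeight w δ) (e : E) :
    Measurable (dirKernel w e) :=
  (by fun_prop : Measurable fun h : E => ⟪e, h⟫).mul (hw.measurable.comp measurable_norm)

/-- Averaging a `C^{1,1}` function against the odd kernel approximates the derivative. -/
lemma IsRadialWeight.abs_integral_dirKernel_sub_le (hw : IsRadialWeight w δ) {e : E} (he : ‖e‖ = 1)
    {φ : E → ℝ} (hφ : Differentiable ℝ φ) {K : NNReal} (hK : LipschitzWith K (fderiv ℝ φ)) (y : E) :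
    |(∫ x, φ x * dirKernel w e (x - y)) -
      secondMoment E w / Module.finrank ℝ E * fderiv ℝ φ y e| ≤ K * δ * secondMoment E w := by
  have hd : (Module.finrank ℝ E : ℝ) ≠ 0 := by
    have : Nontrivial E := ⟨e, 0, by rintro rfl; simp at he⟩
    exact_mod_cast Module.finrank_pos.ne'
  have hshift : ∫ x, φ x * dirKernel w e (x - y) = ∫ h, φ (y + h) * dirKernel w e h := by
    rw [← integral_add_left_eq_self _ y]
    simp
  have hki : ∀ {ψ : E → ℝ}, Continuous ψ → Integrable fun h => ψ h * dirKernel w e h := by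
    intro ψ hψ
    have := hw.integrable_mul (ψ := fun h => ψ h * ⟪e, h⟫) (by fun_prop)
    simpa only [dirKernel, mul_assoc] using this
  have hφc : Continuous φ := hφ.continuous
  have hlin : ∫ h, fderiv ℝ φ y h * dirKernel w e h =
      secondMoment E w / Module.finrank ℝ E * fderiv ℝ φ y e := by
    set a := (InnerProductSpace.toDual ℝ E).symm (fderiv ℝ φ y) with ha
    have hay : ∀ h, fderiv ℝ φ y h = ⟪a, h⟫ := fun h => by
      rw [ha, InnerProductSpace.toDual_symm_apply]
    have h1 := hw.integral_inner_mul_inner a e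
    simp only [hay, dirKernel, ← mul_assoc]
    field_simp
    linarith
  have hconst : ∫ h, φ y * dirKernel w e h = 0 := by
    rw [integral_const_mul, integral_dirKernel, mul_zero]
  have hcont1 : Continuous fun h => φ (y + h) := by fun_prop
  have hcont2 : Continuous fun h => fderiv ℝ φ y h := (fderiv ℝ φ y).continuous
  have hrepr : (∫ x, φ x * dirKernel w e (x - y)) -
      secondMoment E w / Module.finrank ℝ E * fderiv ℝ φ y e =
      ∫ h, (φ (y + h) - φ y - fderiv ℝ φ y h) * dirKernel w e h := by
    simp only [sub_mul]
    rw [integral_sub (by exact (hki hcont1).sub (hki continuous_const)) (hki hcont2),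
      integral_sub (hki hcont1) (hki continuous_const), hconst, hlin, hshift, sub_zero]
  rw [hrepr, ← Real.norm_eq_abs, secondMoment, ← integral_const_mul]
  refine norm_integral_le_of_norm_le ((hw.integrable_mul (by fun_prop)).const_mul _)
    (.of_forall fun h => ?_)
  rcases le_or_gt δ ‖h‖ with hh | hh
  · simp [hw.dirKernel_eq_zero e hh, hw.eq_zero _ hh]
  · have htaylor : ‖φ (y + h) - φ y - fderiv ℝ φ y h‖ ≤ K * ‖h‖ * ‖h‖ := by
      have := (convex_closedBall y ‖h‖).norm_image_sub_le_of_norm_hasFDerivWithin_le'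
        (f := φ) (f' := fderiv ℝ φ) (φ := fderiv ℝ φ y) (C := K * ‖h‖) (x := y) (y := y + h)
        (fun x _ => (hφ x).hasFDerivAt.hasFDerivWithinAt) (fun x hx => ?_) (by simp) (by simp)
      · simpa using this
      · refine (hK.norm_sub_le x y).trans ?_
        gcongr
        rw [← dist_eq_norm]; exact hx
    have hk := hw.abs_dirKernel_le he h
    have hw0 := hw.nonneg ‖h‖
    rw [norm_mul, Real.norm_eq_abs (dirKernel w e h)]
    calc _ ≤ K * ‖h‖ * ‖h‖ * (‖h‖ * w ‖h‖) := by gcongr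
      _ = K * ‖h‖ * (‖h‖ ^ 2 * w ‖h‖) := by ring
      _ ≤ _ := by gcongr

lemma IsRadialWeight.integral_mul_conv_swap (hw : IsRadialWeight w δ) {e : E} (he : ‖e‖ = 1)
    {φ F : E → ℝ} (hφ : Integrable φ) (hF : Integrable F) :
    ∫ x, φ x * ∫ y, F y * dirKernel w e (x - y) =
      ∫ y, F y * ∫ x, φ x * dirKernel w e (x - y) := by
  obtain ⟨C, hC⟩ := hw.exists_dirKernel_bound he
  have h := integral_integral_swap (μ := (volume : Measure E)) (ν := (volume : Measure E))
    (f := fun x y => φ x * F y * dirKernel w e (x - y))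
    ((hφ.mul_prod hF).mul_bdd (c := C)
      ((hw.measurable_dirKernel e).comp (measurable_fst.sub measurable_snd)).aestronglyMeasurable
      (.of_forall fun z => hC _))
  simp only [← integral_const_mul]
  convert h using 5
  all_goals first | rfl | ring_nf

/-- Pairing the nonlocal difference quotient with a test function approximates minus the
distributional derivative, up to an error of the size of the support of the profile. -/
lemma IsRadialWeight.abs_integral_nonlocalDeriv_sub_le (hw : IsRadialWeight w δ) {e : E}
    (he : ‖e‖ = 1) (hm : 0 < secondMoment E w) {R r r' : ℝ} (hr : r + δ ≤ r') (hδ : 0 < δ)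
    (hr' : r' < R) {f : E → ℝ} (hf : LocallyIntegrableOn f (ball 0 R)) {φ : E → ℝ}
    (hφ : ContDiff ℝ 1 φ) (hφs : tsupport φ ⊆ ball 0 r) {K : NNReal}
    (hK : LipschitzWith K (fderiv ℝ φ)) :
    |(∫ x in ball 0 R, φ x * nonlocalDeriv w e (ball 0 R) f x) -
      ∫ x in ball 0 R, f x * fderiv ℝ φ x e| ≤
      K * δ * Module.finrank ℝ E * ∫ x in closedBall 0 r', |f x| := by
  have hd : (0 : ℝ) < Module.finrank ℝ E := by
    have : Nontrivial E := ⟨e, 0, by rintro rfl; simp at he⟩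
    exact_mod_cast Module.finrank_pos
  set c := secondMoment E w / Module.finrank ℝ E with hc
  have hc0 : 0 < c := div_pos hm hd
  have hφ0 : ∀ x, x ∉ ball (0 : E) r → φ x = 0 := fun x hx =>
    image_eq_zero_of_notMem_tsupport fun h => hx (hφs h)
  have hφ'0 : ∀ x, x ∉ ball (0 : E) r → fderiv ℝ φ x = 0 := fun x hx =>
    image_eq_zero_of_notMem_tsupport fun h => hx (hφs (tsupport_fderiv_subset ℝ h))
  have hcs : HasCompactSupport φ :=
    (isCompact_closedBall (0 : E) r).of_isClosed_subset (isClosed_tsupport φ)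
      (hφs.trans ball_subset_closedBall)
  have hφi : Integrable φ := hφ.continuous.integrable_of_hasCompactSupport hcs
  have hsub : closedBall (0 : E) r' ⊆ ball 0 R := closedBall_subset_ball hr'
  have hsub' : ball (0 : E) r ⊆ closedBall 0 r' :=
    ball_subset_closedBall.trans (closedBall_subset_closedBall (by linarith))
  set F : E → ℝ := (closedBall (0 : E) r').indicator f with hF
  have hFi : Integrable F :=
    (hf.integrableOn_compact_subset hsub (isCompact_closedBall _ _)).integrable_indicator
      measurableSet_closedBall
  obtain ⟨C, hC⟩ := hw.exists_dirKernel_bound he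
  have hkm : ∀ x, Measurable fun y => dirKernel w e (x - y) := fun x =>
    (hw.measurable_dirKernel e).comp (by fun_prop)
  have hk0 : ∀ x, ∫ y, dirKernel w e (x - y) = 0 := fun x => by
    rw [integral_sub_left_eq_self (dirKernel w e) volume x, integral_dirKernel]
  have hkint : Integrable (dirKernel w e) := by
    have := hw.integrable_mul (ψ := fun h : E => ⟪e, h⟫) (by fun_prop)
    exact this
  have hA : ∫ x in ball 0 R, φ x * nonlocalDeriv w e (ball 0 R) f x =
      c⁻¹ * ∫ x, φ x * ∫ y, F y * dirKernel w e (x - y) := by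
    rw [← integral_const_mul, setIntegral_eq_integral_of_forall_compl_eq_zero]
    · refine integral_congr_ae (.of_forall fun x => ?_)
      by_cases hx : x ∈ ball (0 : E) r
      · have h1 : ∫ y in ball 0 R, (f y - f x) * dirKernel w e (x - y) =
            ∫ y, F y * dirKernel w e (x - y) := by
          rw [setIntegral_eq_integral_of_forall_compl_eq_zero]
          · have h2 : ∀ y, (f y - f x) * dirKernel w e (x - y) =
                F y * dirKernel w e (x - y) - f x * dirKernel w e (x - y) := by
              intro y
              by_cases hy : y ∈ closedBall (0 : E) r'
              · rw [hF, indicator_of_mem hy]; ring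
              · rw [hw.dirKernel_eq_zero e (h := x - y)]
                · ring
                · rw [mem_closedBall_zero_iff, not_le] at hy
                  rw [mem_ball_zero_iff] at hx
                  have := norm_sub_norm_le y x
                  rw [norm_sub_rev] at this
                  linarith
            simp only [h2]
            rw [integral_sub, integral_const_mul, hk0, mul_zero, sub_zero]
            · exact hFi.mul_bdd (hkm x).aestronglyMeasurable (.of_forall fun y => hC _)
            · exact ((hkint.comp_sub_left x)).const_mul _
          · intro y hy
            rw [hw.dirKernel_eq_zero e (h := x - y), mul_zero]
            rw [mem_ball_zero_iff, not_lt] at hy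
            rw [mem_ball_zero_iff] at hx
            have := norm_sub_norm_le y x
            rw [norm_sub_rev] at this
            linarith
        simp only [nonlocalDeriv, h1]
        ring
      · simp [hφ0 x hx]
    · intro x hx
      rw [hφ0 x fun h => hx (hsub (hsub' h)), zero_mul]
  have hB : ∫ x in ball 0 R, f x * fderiv ℝ φ x e = ∫ x, F x * fderiv ℝ φ x e := by
    rw [setIntegral_eq_integral_of_forall_compl_eq_zero]
    · refine integral_congr_ae (.of_forall fun x => ?_)
      by_cases hx : x ∈ ball (0 : E) r
      · simp only [hF, indicator_of_mem (hsub' hx)]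
      · simp [hφ'0 x hx]
    · intro x hx
      rw [hφ'0 x fun h => hx (hsub (hsub' h))]
      simp
  have hbound : ∀ y, |c⁻¹ * (∫ x, φ x * dirKernel w e (x - y)) - fderiv ℝ φ y e| ≤
      K * δ * Module.finrank ℝ E := by
    intro y
    have h1 := hw.abs_integral_dirKernel_sub_le he (hφ.differentiable one_ne_zero) hK y
    rw [← hc] at h1
    have h2 : c⁻¹ * (∫ x, φ x * dirKernel w e (x - y)) - fderiv ℝ φ y e =
        c⁻¹ * ((∫ x, φ x * dirKernel w e (x - y)) - c * fderiv ℝ φ y e) := by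
      field_simp
    have h3 : secondMoment E w = c * Module.finrank ℝ E := by rw [hc]; field_simp
    rw [h2, abs_mul, abs_of_pos (inv_pos.2 hc0), inv_mul_le_iff₀ hc0]
    rw [h3] at h1
    linarith
  have hfd : Integrable fun y => F y * fderiv ℝ φ y e := by
    obtain ⟨D, hD⟩ := (hcs.fderiv ℝ).exists_bound_of_continuous (hφ.continuous_fderiv one_ne_zero)
    refine hFi.mul_bdd (c := D) ?_ (.of_forall fun y => ?_)
    · exact ((hφ.continuous_fderiv one_ne_zero).clm_apply continuous_const).aestronglyMeasurable
    · refine ((fderiv ℝ φ y).le_opNorm e).trans ?_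
      rw [he, mul_one]; exact hD y
  have hconvm : AEStronglyMeasurable (fun y => ∫ x, φ x * dirKernel w e (x - y)) volume := by
    have : StronglyMeasurable (Function.uncurry fun y x => φ x * dirKernel w e (x - y)) := by
      refine Measurable.stronglyMeasurable ?_
      exact (hφ.continuous.measurable.comp measurable_snd).mul
        ((hw.measurable_dirKernel e).comp (measurable_snd.sub measurable_fst))
    exact this.integral_prod_right.aestronglyMeasurable
  have hconvb : ∀ y, ‖∫ x, φ x * dirKernel w e (x - y)‖ ≤ ∫ x, ‖φ x‖ * C := by
    intro y
    refine norm_integral_le_of_norm_le (hφi.norm.mul_const C) (.of_forall fun x => ?_)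
    rw [norm_mul]
    gcongr
    exact hC _
  rw [hA, hB, hw.integral_mul_conv_swap he hφi hFi, ← integral_const_mul, ← integral_sub
    ((hFi.mul_bdd hconvm (.of_forall hconvb)).const_mul _) hfd, ← Real.norm_eq_abs]
  have hFabs : ∫ x in closedBall 0 r', |f x| = ∫ x, |F x| := by
    rw [← integral_indicator measurableSet_closedBall]
    refine integral_congr_ae (.of_forall fun x => ?_)
    by_cases hx : x ∈ closedBall (0 : E) r' <;> simp [hF, hx, -mem_closedBall]
  rw [hFabs, ← integral_const_mul]
  refine norm_integral_le_of_norm_le (hFi.abs.const_mul _) (.of_forall fun y => ?_)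
  have h1 : c⁻¹ * (F y * ∫ x, φ x * dirKernel w e (x - y)) - F y * fderiv ℝ φ y e =
      F y * (c⁻¹ * (∫ x, φ x * dirKernel w e (x - y)) - fderiv ℝ φ y e) := by ring
  rw [h1, norm_mul, mul_comm]
  exact mul_le_mul_of_nonneg_right (hbound y) (norm_nonneg _)

end RadialKernel

section GagliardoEnergy

variable {E : Type*} [NormedAddCommGroup E] [InnerProductSpace ℝ E] [FiniteDimensional ℝ E]
  [MeasurableSpace E] [BorelSpace E] {w : ℝ → ℝ} {δ p q : ℝ}

/-- The double integral `∫_B ∫_B |f x - f y| ^ p / ‖x - y‖ ^ β`. -/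
noncomputable def gagliardoEnergy {E : Type*} [NormedAddCommGroup E] [MeasureSpace E] (B : Set E)
    (f : E → ℝ) (p β : ℝ) : ℝ≥0∞ :=
  ∫⁻ x in B, ∫⁻ y in B, ENNReal.ofReal (|f x - f y| ^ p / ‖x - y‖ ^ β)

lemma mul_weight_le_rpow_mul_rpow (hpq : p.HolderConjugate q) {a r W β : ℝ} (ha : 0 ≤ a)
    (hr : 0 < r) (hW : 0 ≤ W) (hWβ : W * r ^ (2 - p) ≤ r ^ (-β)) :
    a * (r * W) ≤ (a ^ p / r ^ β) ^ (1 / p) * (r ^ 2 * W) ^ (1 / q) := by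
  have hp := hpq.pos
  have hq := hpq.symm.pos
  have hsum : 1 / p + 1 / q = 1 := by simpa using hpq.inv_add_inv_eq_one
  have hexp : (2 - p) * (1 / p) + 2 * (1 / q) = 1 := by
    have : (2 - p) * (1 / p) = 2 * (1 / p) - 1 := by field_simp
    linarith
  have h1 : a ^ p * (W * r ^ (2 - p)) ≤ a ^ p / r ^ β := by
    rw [div_eq_mul_inv, ← Real.rpow_neg hr.le]
    gcongr
  calc a * (r * W) = (a ^ p * (W * r ^ (2 - p))) ^ (1 / p) * (r ^ 2 * W) ^ (1 / q) := by
        rw [Real.mul_rpow (by positivity) (by positivity), Real.mul_rpow hW (by positivity),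
          Real.mul_rpow (by positivity) hW, ← Real.rpow_natCast, ← Real.rpow_mul hr.le,
          ← Real.rpow_mul hr.le, ← Real.rpow_mul ha, mul_one_div_cancel hp.ne', Real.rpow_one]
        have h2 : W ^ (1 / p) * W ^ (1 / q) = W := by
          rw [← Real.rpow_add' hW (by rw [hsum]; exact one_ne_zero), hsum, Real.rpow_one]
        have h3 : r ^ ((2 - p) * (1 / p)) * r ^ (((2 : ℕ) : ℝ) * (1 / q)) = r := by
          rw [← Real.rpow_add hr]
          push_cast
          rw [hexp, Real.rpow_one]
        calc a * (r * W) = a * ((r ^ ((2 - p) * (1 / p)) * r ^ (((2 : ℕ) : ℝ) * (1 / q))) *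
              (W ^ (1 / p) * W ^ (1 / q))) := by rw [h2, h3]
          _ = _ := by ring
    _ ≤ _ := by gcongr

lemma IsRadialWeight.measurable_nonlocalDeriv (hw : IsRadialWeight w δ) (e : E) (B : Set E)
    {f : E → ℝ} (hf : Measurable f) : Measurable (nonlocalDeriv w e B f) := by
  have : StronglyMeasurable (Function.uncurry fun x y => (f y - f x) * dirKernel w e (x - y)) := by
    refine Measurable.stronglyMeasurable ?_
    exact ((hf.comp measurable_snd).sub (hf.comp measurable_fst)).mul
      ((hw.measurable_dirKernel e).comp (measurable_fst.sub measurable_snd))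
  exact (this.integral_prod_right (ν := volume.restrict B)).measurable.const_mul _

/-- The nonlocal difference quotient is bounded in `Lᵖ` by the Gagliardo energy, as soon as the
profile is dominated by the energy kernel. -/
lemma IsRadialWeight.lintegral_nonlocalDeriv_le (hw : IsRadialWeight w δ) {e : E} (he : ‖e‖ = 1)
    (hm : 0 < secondMoment E w) (hp : 1 < p) {β : ℝ} (hw0 : w 0 = 0)
    (hwβ : ∀ r, 0 < r → w r * r ^ (2 - p) ≤ r ^ (-β)) (B : Set E) {f : E → ℝ} (hf : Measurable f) :
    ∫⁻ x in B, ‖nonlocalDeriv w e B f x‖ₑ ^ p ≤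
      ENNReal.ofReal ((Module.finrank ℝ E : ℝ) ^ p * (secondMoment E w)⁻¹) *
        gagliardoEnergy B f p β := by
  have hpq : p.HolderConjugate p.conjExponent := .conjExponent hp
  set q := p.conjExponent
  have hp0 : 0 < p := hpq.pos
  have hq0 : 0 < q := hpq.symm.pos
  set m := secondMoment E w with hmdef
  have hd : (0 : ℝ) < Module.finrank ℝ E := by
    have : Nontrivial E := ⟨e, 0, by rintro rfl; simp at he⟩
    exact_mod_cast Module.finrank_pos
  rw [gagliardoEnergy, ← lintegral_const_mul' _ _ ENNReal.ofReal_ne_top]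
  refine lintegral_mono fun x => ?_
  simp only
  set I := ∫⁻ y in B, ENNReal.ofReal (|f x - f y| ^ p / ‖x - y‖ ^ β)
  set u : E → ℝ≥0∞ := fun y => ENNReal.ofReal ((|f x - f y| ^ p / ‖x - y‖ ^ β) ^ (1 / p)) with hu
  set v : E → ℝ≥0∞ := fun y => ENNReal.ofReal ((‖x - y‖ ^ 2 * w ‖x - y‖) ^ (1 / q)) with hv
  have hum : Measurable u := by
    have hfm : Measurable fun y => f x - f y := measurable_const.sub hf
    have : Measurable fun y => |f x - f y| := by simpa only [Real.norm_eq_abs] using hfm.norm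
    exact (((this.pow_const p).div ((by fun_prop : Measurable fun y => ‖x - y‖).pow_const
      β)).pow_const _).ennreal_ofReal
  have hnm : Measurable fun y : E => ‖x - y‖ := by fun_prop
  have hvm : Measurable v :=
    (((hnm.pow_const 2).mul (hw.measurable.comp hnm)).pow_const _).ennreal_ofReal
  have hup : ∀ y, u y ^ p = ENNReal.ofReal (|f x - f y| ^ p / ‖x - y‖ ^ β) := by
    intro y
    rw [hu]
    simp only
    rw [ENNReal.ofReal_rpow_of_nonneg (by positivity) hp0.le, ← Real.rpow_mul (by positivity),
      one_div_mul_cancel hp0.ne', Real.rpow_one]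
  have hvq : ∀ y, v y ^ q = ENNReal.ofReal (‖x - y‖ ^ 2 * w ‖x - y‖) := by
    intro y
    have := hw.nonneg ‖x - y‖
    rw [hv]
    simp only
    rw [ENNReal.ofReal_rpow_of_nonneg (by positivity) hq0.le, ← Real.rpow_mul (by positivity),
      one_div_mul_cancel hq0.ne', Real.rpow_one]
  have hvint : ∫⁻ y in B, v y ^ q ≤ ENNReal.ofReal m := by
    simp only [hvq]
    refine (setLIntegral_le_lintegral _ _).trans_eq ?_
    rw [hmdef, secondMoment, ofReal_integral_eq_lintegral_ofReal
      (hw.integrable_mul (ψ := fun h : E => ‖h‖ ^ 2) (by fun_prop))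
      (.of_forall fun h => mul_nonneg (by positivity) (hw.nonneg _))]
    exact lintegral_sub_left_eq_self (fun h : E => ENNReal.ofReal (‖h‖ ^ 2 * w ‖h‖)) x
  have hpt : ∀ y, ‖(f y - f x) * dirKernel w e (x - y)‖ₑ ≤ (u * v) y := by
    intro y
    rw [Real.enorm_eq_ofReal_abs, Pi.mul_apply, hu, hv]
    simp only
    rw [← ENNReal.ofReal_mul (by positivity)]
    refine ENNReal.ofReal_le_ofReal ?_
    rw [abs_mul, abs_sub_comm]
    have hk := hw.abs_dirKernel_le he (x - y)
    refine (mul_le_mul_of_nonneg_left hk (abs_nonneg _)).trans ?_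
    rcases (norm_nonneg (x - y)).eq_or_lt with h0 | h0
    · rw [← h0, hw0]
      simp only [mul_zero]
      positivity
    · exact mul_weight_le_rpow_mul_rpow hpq (abs_nonneg _) h0 (hw.nonneg _) (hwβ _ h0)
  have hI : ‖∫ y in B, (f y - f x) * dirKernel w e (x - y)‖ₑ ≤
      I ^ (1 / p) * ENNReal.ofReal m ^ (1 / q) := by
    refine (enorm_integral_le_lintegral_enorm _).trans ((lintegral_mono hpt).trans ?_)
    refine (ENNReal.lintegral_mul_le_Lp_mul_Lq _ hpq hum.aemeasurable hvm.aemeasurable).trans ?_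
    simp only [hup]
    gcongr
  have hmd : 0 < m / Module.finrank ℝ E := div_pos hm hd
  calc ‖nonlocalDeriv w e B f x‖ₑ ^ p
      ≤ (ENNReal.ofReal (m / Module.finrank ℝ E)⁻¹ *
          (I ^ (1 / p) * ENNReal.ofReal m ^ (1 / q))) ^ p := by
        refine ENNReal.rpow_le_rpow ?_ hp0.le
        rw [nonlocalDeriv, enorm_mul, Real.enorm_of_nonneg (inv_nonneg.2 hmd.le)]
        gcongr
    _ = ENNReal.ofReal ((m / Module.finrank ℝ E)⁻¹ ^ p * m ^ (p - 1)) * I := by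
        rw [ENNReal.mul_rpow_of_nonneg _ _ hp0.le, ENNReal.mul_rpow_of_nonneg _ _ hp0.le,
          ← ENNReal.rpow_mul, ← ENNReal.rpow_mul, one_div_mul_cancel hp0.ne', ENNReal.rpow_one,
          ENNReal.ofReal_rpow_of_nonneg (by positivity) hp0.le,
          ENNReal.ofReal_rpow_of_nonneg hm.le (by positivity),
          ENNReal.ofReal_mul (by positivity), one_div_mul_eq_div, hpq.div_conj_eq_sub_one]
        ring
    _ = _ := by
        congr 2
        rw [inv_div, Real.div_rpow hd.le hm.le, Real.rpow_sub_one hm.ne']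
        have := (Real.rpow_pos_of_pos hm p).ne'
        field_simp

lemma isRadialWeight_indicator_rpow {η : ℝ} (hη : 0 < η) (γ : ℝ) :
    IsRadialWeight ((Ioo η δ).indicator fun r => r ^ γ) δ where
  measurable := (measurable_id.pow_const γ).indicator measurableSet_Ioo
  nonneg r := indicator_nonneg (fun r hr => Real.rpow_nonneg (hη.trans hr.1).le _) r
  bounded := by
    have hc : ContinuousOn (fun r : ℝ => r ^ γ) (Icc η δ) := fun r hr =>
      (Real.continuousAt_rpow_const r γ (.inl (hη.trans_le hr.1).ne')).continuousWithinAt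
    obtain ⟨W, hW⟩ := isCompact_Icc.exists_bound_of_continuousOn hc
    refine ⟨max W 0, fun r => ?_⟩
    by_cases hr : r ∈ Ioo η δ
    · rw [indicator_of_mem hr]
      exact ((le_abs_self _).trans (hW r (Ioo_subset_Icc_self hr))).trans (le_max_left _ _)
    · rw [indicator_of_notMem hr]
      exact le_max_right _ _
  eq_zero r hr := indicator_of_notMem (fun h => h.2.not_ge hr) _

lemma secondMoment_indicator_rpow [Nontrivial E] {η a : ℝ} (hη : 0 < η) (hηδ : η ≤ δ) (ha : 0 < a) :
    secondMoment E ((Ioo η δ).indicator fun r => r ^ (a - 2 - Module.finrank ℝ E)) =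
      Module.finrank ℝ E * volume.real (ball (0 : E) 1) * ((δ ^ a - η ^ a) / a) := by
  have hd : 1 ≤ Module.finrank ℝ E := Module.finrank_pos
  rw [secondMoment, integral_fun_norm_addHaar volume
    (fun r => r ^ 2 * (Ioo η δ).indicator (fun r => r ^ (a - 2 - Module.finrank ℝ E)) r),
    nsmul_eq_mul, smul_eq_mul, mul_assoc]
  congr 2
  have h1 : ∫ y in Ioi (0 : ℝ), y ^ (Module.finrank ℝ E - 1) •
      (y ^ 2 * (Ioo η δ).indicator (fun r => r ^ (a - 2 - Module.finrank ℝ E)) y) =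
      ∫ y in Ioi (0 : ℝ), (Ioo η δ).indicator (fun r => r ^ (a - 1)) y := by
    refine setIntegral_congr_fun measurableSet_Ioi fun y (hy : 0 < y) => ?_
    by_cases hyI : y ∈ Ioo η δ
    · simp only [indicator_of_mem hyI, smul_eq_mul]
      rw [← Real.rpow_natCast, ← Real.rpow_natCast, ← Real.rpow_add hy, ← Real.rpow_add hy]
      congr 1
      push_cast [Nat.cast_sub hd]
      ring
    · simp [indicator_of_notMem hyI]
  have h2 : Ioi (0 : ℝ) ∩ Ioo η δ = Ioo η δ := inter_eq_right.2 fun y hy => hη.trans hy.1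
  rw [h1, setIntegral_indicator measurableSet_Ioo, h2, ← integral_Ioc_eq_integral_Ioo,
    ← intervalIntegral.integral_of_le hηδ, integral_rpow (.inl (by linarith)), sub_add_cancel]

/-- For every scale `δ` and `s` close to `1`, there is a radial profile at scale `δ` whose nonlocal
difference quotients are controlled in `Lᵖ` by the normalized Gagliardo energy. -/
theorem exists_radialWeight_lintegral_le (E : Type*) [NormedAddCommGroup E] [InnerProductSpace ℝ E]
    [FiniteDimensional ℝ E] [MeasurableSpace E] [BorelSpace E] (hp : 1 < p) :
    ∃ C > 0, ∀ s < 1, ∀ δ > 0, 1 / 2 ≤ δ ^ (p * (1 - s)) → ∀ e : E, ‖e‖ = 1 →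
      ∃ w, IsRadialWeight w δ ∧ 0 < secondMoment E w ∧ ∀ (B : Set E) (f : E → ℝ), Measurable f →
        ∫⁻ x in B, ‖nonlocalDeriv w e B f x‖ₑ ^ p ≤ ENNReal.ofReal C *
          (ENNReal.ofReal (1 - s) * gagliardoEnergy B f p (Module.finrank ℝ E + s * p)) := by
  set d : ℝ := (Module.finrank ℝ E : ℝ) with hddef
  set V := volume.real (ball (0 : E) 1)
  have hV : 0 < V := ENNReal.toReal_pos (measure_ball_pos _ _ one_pos).ne' measure_ball_lt_top.ne
  have hd0 : 0 ≤ d := by positivity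
  refine ⟨d ^ p * (4 * p / (d * V)) + 1, by positivity, fun s hs δ hδ hδs e he => ?_⟩
  have : Nontrivial E := ⟨e, 0, by rintro rfl; simp at he⟩
  have hd : 0 < d := by rw [hddef]; exact_mod_cast Module.finrank_pos
  set a := p * (1 - s) with ha
  have ha0 : 0 < a := mul_pos (by linarith) (by linarith)
  set η := δ * (1 / 2) ^ (1 / a) with hη
  have hη0 : 0 < η := by positivity
  have hηδ : η ≤ δ :=
    mul_le_of_le_one_right hδ.le (Real.rpow_le_one (by norm_num) (by norm_num) (by positivity))
  have hηa : η ^ a = δ ^ a / 2 := by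
    rw [hη, Real.mul_rpow hδ.le (by positivity), ← Real.rpow_mul (by norm_num),
      one_div_mul_cancel ha0.ne', Real.rpow_one]
    ring
  set w : ℝ → ℝ := (Ioo η δ).indicator fun r => r ^ (a - 2 - Module.finrank ℝ E) with hwdef
  have hw : IsRadialWeight w δ := isRadialWeight_indicator_rpow hη0 _
  have hmoment : secondMoment E w = d * V * (δ ^ a / (2 * a)) := by
    rw [hwdef, secondMoment_indicator_rpow hη0 hηδ ha0, hηa]
    field_simp
    ring
  have hm : 0 < secondMoment E w := by rw [hmoment]; positivity
  refine ⟨w, hw, hm, fun B f hf => ?_⟩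
  refine (hw.lintegral_nonlocalDeriv_le he hm hp (β := d + s * p)
    (indicator_of_notMem (fun h => hη0.not_gt h.1) _) (fun r hr => ?_) B hf).trans ?_
  · by_cases hrI : r ∈ Ioo η δ
    · rw [hwdef, indicator_of_mem hrI, ← Real.rpow_add hr, ← hddef]
      refine le_of_eq ?_
      congr 1
      rw [ha]; ring
    · rw [hwdef, indicator_of_notMem hrI, zero_mul]
      positivity
  · rw [← mul_assoc, ← ENNReal.ofReal_mul (by positivity)]
    gcongr ENNReal.ofReal ?_ * _
    have h1 : (secondMoment E w)⁻¹ ≤ 4 * p / (d * V) * (1 - s) := by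
      rw [hmoment]
      have h2 : d * V / (4 * a) ≤ d * V * (δ ^ a / (2 * a)) := by
        calc d * V / (4 * a) = d * V * ((1 / 2) / (2 * a)) := by field_simp; norm_num
          _ ≤ _ := by gcongr
      refine (inv_anti₀ (by positivity) h2).trans_eq ?_
      rw [ha, inv_div]
      ring
    calc d ^ p * (secondMoment E w)⁻¹ ≤ d ^ p * (4 * p / (d * V) * (1 - s)) := by gcongr
      _ = d ^ p * (4 * p / (d * V)) * (1 - s) := by ring
      _ ≤ _ := by
        gcongr
        linarith

/-- Existence of a weak directional derivative, controlled by the lower limit of the normalized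
Gagliardo energies. -/
theorem exists_weak_directional_deriv (E : Type*) [NormedAddCommGroup E] [InnerProductSpace ℝ E]
    [FiniteDimensional ℝ E] [MeasurableSpace E] [BorelSpace E] (hp : 1 < p) :
    ∃ C > 0, ∀ (R : ℝ) (f : E → ℝ), Measurable f → LocallyIntegrableOn f (ball 0 R) →
      liminf (fun s : ℝ => ENNReal.ofReal (1 - s) *
        gagliardoEnergy (ball (0 : E) R) f p (Module.finrank ℝ E + s * p))
        (nhdsWithin 1 (Iio 1)) ≠ ⊤ → ∀ e : E, ‖e‖ = 1 →
      ∃ g : E → ℝ, Measurable g ∧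
        ∫⁻ x in ball (0 : E) R, ‖g x‖ₑ ^ p ≤ ENNReal.ofReal C *
          liminf (fun s : ℝ => ENNReal.ofReal (1 - s) *
            gagliardoEnergy (ball (0 : E) R) f p (Module.finrank ℝ E + s * p))
            (nhdsWithin 1 (Iio 1)) ∧
        ∀ φ : E → ℝ, ContDiff ℝ (⊤ : ℕ∞) φ → HasCompactSupport φ → tsupport φ ⊆ ball (0 : E) R →
          ∫ x in ball (0 : E) R, φ x * g x = ∫ x in ball (0 : E) R, f x * fderiv ℝ φ x e := by
  obtain ⟨C, hC, hex⟩ := exists_radialWeight_lintegral_le E hp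
  refine ⟨C, hC, fun R f hf hfl hL e he => ?_⟩
  set En : ℝ → ℝ≥0∞ := fun s => ENNReal.ofReal (1 - s) *
    gagliardoEnergy (ball (0 : E) R) f p (Module.finrank ℝ E + s * p) with hEn
  set L := liminf En (nhdsWithin 1 (Iio 1)) with hLdef
  have hδ : ∀ k : ℕ, (0 : ℝ) < 1 / (k + 1) := fun k => by positivity
  have hseq : ∀ k : ℕ, ∃ s < 1, 1 / 2 ≤ (1 / (k + 1) : ℝ) ^ (p * (1 - s)) ∧
      En s < L + (((k + 1 : ℕ) : ℝ≥0∞))⁻¹ := by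
    intro k
    have h1 : ∃ᶠ s in nhdsWithin (1 : ℝ) (Iio 1), En s < L + (((k + 1 : ℕ) : ℝ≥0∞))⁻¹ :=
      frequently_lt_of_liminf_lt (by isBoundedDefault)
        (ENNReal.lt_add_right hL (by simp))
    have h2 : Tendsto (fun s : ℝ => (1 / (k + 1) : ℝ) ^ (p * (1 - s))) (nhdsWithin 1 (Iio 1))
        (nhds 1) := by
      have : Continuous fun s : ℝ => (1 / (k + 1) : ℝ) ^ (p * (1 - s)) :=
        Continuous.rpow continuous_const (by fun_prop) fun _ => .inl (hδ k).ne'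
      have h3 := (this.tendsto 1).mono_left (nhdsWithin_le_nhds (s := Iio 1))
      simpa using h3
    have h3 := h2.eventually (eventually_ge_nhds (by norm_num : (1 / 2 : ℝ) < 1))
    obtain ⟨s, hs1, hs2, hs3⟩ := (h1.and_eventually (h3.and self_mem_nhdsWithin)).exists
    exact ⟨s, hs3, hs2, hs1⟩
  choose s hs1 hs2 hs3 using hseq
  choose w hw hm hwle using fun k => hex (s k) (hs1 k) (1 / (k + 1)) (hδ k) (hs2 k) e he
  have : IsFiniteMeasure (volume.restrict (ball (0 : E) R)) :=
    ⟨by rw [Measure.restrict_apply_univ]; exact measure_ball_lt_top⟩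
  have hinv : Tendsto (fun k : ℕ => (((k + 1 : ℕ) : ℝ≥0∞))⁻¹) atTop (nhds 0) :=
    ENNReal.tendsto_inv_nat_nhds_zero.comp (tendsto_add_atTop_nat 1)
  have hmt : Tendsto (fun k : ℕ => ENNReal.ofReal C * (L + (((k + 1 : ℕ) : ℝ≥0∞))⁻¹)) atTop
      (nhds (ENNReal.ofReal C * L)) := by
    refine ENNReal.Tendsto.const_mul ?_ (.inr ENNReal.ofReal_ne_top)
    simpa using (tendsto_const_nhds (x := L)).add hinv
  obtain ⟨g, hgm, hgle, hg⟩ := exists_weak_limit_of_lp_bounded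
    (μ := volume.restrict (ball (0 : E) R)) hp
    (G := fun k => nonlocalDeriv (w k) e (ball 0 R) f)
    (fun k => (hw k).measurable_nonlocalDeriv e _ hf) (K := ENNReal.ofReal C * (L + 1))
    (ENNReal.mul_ne_top ENNReal.ofReal_ne_top (by simp [hL]))
    (m := fun k => ENNReal.ofReal C * (L + (((k + 1 : ℕ) : ℝ≥0∞))⁻¹)) (fun k => by
      gcongr
      simp) hmt (fun k => (hwle k _ f hf).trans (by gcongr; exact (hs3 k).le))
  refine ⟨g, hgm, hgle, fun φ hφ hφc hφs => ?_⟩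
  obtain ⟨D, hD⟩ := hφc.exists_bound_of_continuous hφ.continuous
  refine hg φ hφ.continuous.measurable D hD _ ?_
  have hφ' : ContDiff ℝ 1 (fderiv ℝ φ) := hφ.fderiv_right (by norm_cast)
  obtain ⟨K, hK⟩ := ContDiff.lipschitzWith_of_hasCompactSupport (𝕂 := ℝ) (hφc.fderiv ℝ) hφ'
    one_ne_zero
  obtain ⟨r, hrR, hr⟩ := exists_lt_subset_ball (isClosed_tsupport φ) hφs
  have hδt : Tendsto (fun k : ℕ => (1 / (k + 1) : ℝ)) atTop (nhds 0) :=
    tendsto_one_div_add_atTop_nhds_zero_nat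
  rw [tendsto_iff_norm_sub_tendsto_zero]
  have hbd : Tendsto (fun k : ℕ => K * (1 / (k + 1) : ℝ) * Module.finrank ℝ E *
      ∫ x in closedBall (0 : E) ((r + R) / 2), |f x|) atTop (nhds 0) := by
    simpa using ((hδt.const_mul (K : ℝ)).mul_const (Module.finrank ℝ E : ℝ)).mul_const
      (∫ x in closedBall (0 : E) ((r + R) / 2), |f x|)
  refine squeeze_zero' (.of_forall fun k => norm_nonneg _) ?_ hbd
  filter_upwards [hδt.eventually (eventually_le_nhds (by linarith : 0 < (R - r) / 2))] with k hk
  exact (hw k).abs_integral_nonlocalDeriv_sub_le he (hm k) (by linarith) (hδ k) (by linarith) hfl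
    (hφ.of_le (by norm_cast)) hr hK

end GagliardoEnergy

section Main

lemma gagliardoEnergy_congr {E : Type*} [NormedAddCommGroup E] [MeasureSpace E] {B : Set E}
    {f f' : E → ℝ} (h : f =ᵐ[volume.restrict B] f') (p β : ℝ) :
    gagliardoEnergy B f p β = gagliardoEnergy B f' p β := by
  refine lintegral_congr_ae ?_
  filter_upwards [h] with x hx
  refine lintegral_congr_ae ?_
  filter_upwards [h] with y hy
  rw [hx, hy]

lemma LocallyIntegrableOn.congr_ae {X : Type*} [TopologicalSpace X] [MeasurableSpace X]
    {μ : Measure X} {s : Set X} {f f' : X → ℝ} (hf : LocallyIntegrableOn f s μ)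
    (h : f =ᵐ[μ.restrict s] f') :
    LocallyIntegrableOn f' s μ := by
  intro x hx
  obtain ⟨t, ht, hft⟩ := hf x hx
  refine ⟨t ∩ s, inter_mem ht self_mem_nhdsWithin, ?_⟩
  exact (hft.mono_set inter_subset_left).congr
    (ae_mono (Measure.restrict_mono inter_subset_right le_rfl) h)

/-- A weak gradient assembled from weak directional derivatives along an orthonormal basis. -/
lemma exists_weak_gradient_of_measurable (n : ℕ) {p : ℝ} (hp : 1 < p) :
    ∃ C > 0, ∀ (R : ℝ) (f : EuclideanSpace ℝ (Fin n) → ℝ), Measurable f →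
      LocallyIntegrableOn f (ball 0 R) →
      liminf (fun s : ℝ => ENNReal.ofReal (1 - s) *
        gagliardoEnergy (ball (0 : EuclideanSpace ℝ (Fin n)) R) f p (n + s * p))
        (nhdsWithin 1 (Iio 1)) ≠ ⊤ →
      ∃ g : EuclideanSpace ℝ (Fin n) → EuclideanSpace ℝ (Fin n), Measurable g ∧
        (∀ φ : EuclideanSpace ℝ (Fin n) → ℝ, ContDiff ℝ (⊤ : ℕ∞) φ → HasCompactSupport φ →
          tsupport φ ⊆ ball 0 R → ∀ v : EuclideanSpace ℝ (Fin n),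
            ∫ x in ball 0 R, f x * fderiv ℝ φ x v = - ∫ x in ball 0 R, ⟪g x, v⟫ * φ x) ∧
        ∫⁻ x in ball 0 R, ‖g x‖ₑ ^ p ≤ ENNReal.ofReal C *
          liminf (fun s : ℝ => ENNReal.ofReal (1 - s) *
            gagliardoEnergy (ball (0 : EuclideanSpace ℝ (Fin n)) R) f p (n + s * p))
            (nhdsWithin 1 (Iio 1)) := by
  obtain ⟨C, hC, hex⟩ := exists_weak_directional_deriv (EuclideanSpace ℝ (Fin n)) hp
  rw [finrank_euclideanSpace_fin] at hex
  have hp0 : 0 < p := by linarith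
  refine ⟨(n : ℝ) ^ (p - 1) * (n * C) + 1, by positivity, fun R f hf hfl hL => ?_⟩
  set b := EuclideanSpace.basisFun (Fin n) ℝ
  set B := ball (0 : EuclideanSpace ℝ (Fin n)) R
  set L := liminf (fun s : ℝ => ENNReal.ofReal (1 - s) *
    gagliardoEnergy B f p (n + s * p)) (nhdsWithin 1 (Iio 1))
  choose g hgm hgle hg using fun i => hex R f hf hfl hL (b i) (b.orthonormal.1 i)
  have : IsFiniteMeasure (volume.restrict B) :=
    ⟨by rw [Measure.restrict_apply_univ]; exact measure_ball_lt_top⟩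
  have hgi : ∀ i, Integrable (g i) (volume.restrict B) := fun i =>
    integrable_of_lintegral_enorm_rpow_ne_top hp (hgm i)
      ((hgle i).trans_lt (ENNReal.mul_lt_top ENNReal.ofReal_lt_top hL.lt_top)).ne
  refine ⟨fun x => -∑ i, g i x • b i, ?_, fun φ hφ hφc hφs v => ?_, ?_⟩
  · exact (Finset.measurable_sum _ fun i _ => (hgm i).smul_const (b i)).neg
  · have hφ' : Continuous (fderiv ℝ φ) := hφ.continuous_fderiv (by norm_cast)
    obtain ⟨D, hD⟩ := hφc.exists_bound_of_continuous hφ.continuous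
    have hfK : IntegrableOn f (tsupport φ) := hfl.integrableOn_compact_subset hφs hφc
    have hint1 : ∀ i, Integrable (fun x => f x * fderiv ℝ φ x (b i)) (volume.restrict B) := by
      intro i
      have hderiv : Continuous fun x => fderiv ℝ φ x (b i) := hφ'.clm_apply continuous_const
      obtain ⟨D', hD'⟩ := (hφc.fderiv_apply ℝ (b i)).exists_bound_of_continuous hderiv
      have hsupp : Function.support (fun x => f x * fderiv ℝ φ x (b i)) ⊆ tsupport φ := by
        intro x hx
        refine support_fderiv_subset ℝ (f := φ) fun h0 => hx ?_
        simp [h0]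
      refine ((integrableOn_iff_integrable_of_support_subset hsupp).1 ?_).integrableOn
      exact hfK.mul_bdd hderiv.aestronglyMeasurable (.of_forall hD')
    have hint2 : ∀ i, Integrable (fun x => φ x * g i x) (volume.restrict B) := fun i =>
      (hgi i).bdd_mul hφ.continuous.aestronglyMeasurable (.of_forall hD)
    have hl : ∀ x, f x * fderiv ℝ φ x v = ∑ i, ⟪b i, v⟫ * (f x * fderiv ℝ φ x (b i)) := by
      intro x
      conv_lhs => rw [← b.sum_repr' v]
      rw [map_sum, Finset.mul_sum]
      refine Finset.sum_congr rfl fun i _ => ?_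
      rw [map_smul, smul_eq_mul]
      ring
    have hr : ∀ x, ⟪-∑ i, g i x • b i, v⟫ * φ x = -∑ i, ⟪b i, v⟫ * (φ x * g i x) := by
      intro x
      rw [inner_neg_left, sum_inner, neg_mul, Finset.sum_mul]
      congr 1
      refine Finset.sum_congr rfl fun i _ => ?_
      rw [real_inner_smul_left]
      ring
    simp only [hl, hr]
    rw [integral_neg, neg_neg, integral_finsetSum _ fun i _ => (hint1 i).const_mul _,
      integral_finsetSum _ fun i _ => (hint2 i).const_mul _]
    refine Finset.sum_congr rfl fun i _ => ?_
    rw [integral_const_mul, integral_const_mul, hg i φ hφ hφc hφs]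
  · have hpt : ∀ x, ‖-∑ i, g i x • b i‖ₑ ^ p ≤ (n : ℝ≥0∞) ^ (p - 1) * ∑ i, ‖g i x‖ₑ ^ p := by
      intro x
      have h1 : ‖-∑ i, g i x • b i‖ₑ ≤ ∑ i, ‖g i x‖ₑ := by
        rw [enorm_neg]
        refine (enorm_sum_le _ _).trans (Finset.sum_le_sum fun i _ => ?_)
        rw [enorm_smul, ← ofReal_norm, ← ofReal_norm (b i), b.orthonormal.1 i]
        simp
      refine (ENNReal.rpow_le_rpow h1 hp0.le).trans ?_
      simpa using ENNReal.rpow_sum_le_const_mul_sum_rpow Finset.univ (fun i => ‖g i x‖ₑ) hp.le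
    calc ∫⁻ x in B, ‖-∑ i, g i x • b i‖ₑ ^ p
        ≤ ∫⁻ x in B, (n : ℝ≥0∞) ^ (p - 1) * ∑ i, ‖g i x‖ₑ ^ p := lintegral_mono hpt
      _ = (n : ℝ≥0∞) ^ (p - 1) * ∑ i, ∫⁻ x in B, ‖g i x‖ₑ ^ p := by
        rw [lintegral_const_mul' _ _ (by finiteness),
          lintegral_finsetSum _ fun i _ => (hgm i).enorm.pow_const p]
      _ ≤ (n : ℝ≥0∞) ^ (p - 1) * ∑ _i : Fin n, ENNReal.ofReal C * L := by
        gcongr with i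
        exact hgle i
      _ = ENNReal.ofReal ((n : ℝ) ^ (p - 1) * (n * C)) * L := by
        rw [Finset.sum_const, Finset.card_univ, Fintype.card_fin, nsmul_eq_mul,
          ENNReal.ofReal_mul (by positivity), ENNReal.ofReal_mul (by positivity),
          ← ENNReal.ofReal_rpow_of_nonneg (by positivity) (by linarith), ENNReal.ofReal_natCast]
        ring
      _ ≤ _ := by gcongr; linarith

end Main

/-- BBM-type criterion: a locally integrable function on a ball whose scaled Gagliardo
energies have finite liminf as `s → 1⁻` has a weak gradient in `Lᵖ`, with norm
controlled by the liminf. -/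
theorem stmt_6 (n : ℕ) (p : ℝ) (hp : 1 < p) :
    ∃ C > 0, ∀ (R : ℝ), 0 < R → ∀ (f : EuclideanSpace ℝ (Fin n) → ℝ),
      LocallyIntegrableOn f (ball (0 : EuclideanSpace ℝ (Fin n)) R) →
      Filter.liminf
          (fun s : ℝ => ENNReal.ofReal (1 - s) *
            ∫⁻ x in ball (0 : EuclideanSpace ℝ (Fin n)) R,
              ∫⁻ y in ball (0 : EuclideanSpace ℝ (Fin n)) R,
                ENNReal.ofReal (|f x - f y| ^ p / ‖x - y‖ ^ ((n : ℝ) + s * p)))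
          (nhdsWithin 1 (Set.Iio 1)) ≠ ⊤ →
      ∃ g : EuclideanSpace ℝ (Fin n) → EuclideanSpace ℝ (Fin n),
        Measurable g ∧
        -- g is the weak gradient of f on the ball
        (∀ φ : EuclideanSpace ℝ (Fin n) → ℝ, ContDiff ℝ (⊤ : ℕ∞) φ → HasCompactSupport φ →
          tsupport φ ⊆ ball (0 : EuclideanSpace ℝ (Fin n)) R →
          ∀ v : EuclideanSpace ℝ (Fin n),
            ∫ x in ball (0 : EuclideanSpace ℝ (Fin n)) R, f x * fderiv ℝ φ x v
              = - ∫ x in ball (0 : EuclideanSpace ℝ (Fin n)) R, ⟪g x, v⟫ * φ x) ∧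
        (∫⁻ x in ball (0 : EuclideanSpace ℝ (Fin n)) R, ENNReal.ofReal (‖g x‖ ^ p))
          ≤ ENNReal.ofReal C *
            Filter.liminf
              (fun s : ℝ => ENNReal.ofReal (1 - s) *
                ∫⁻ x in ball (0 : EuclideanSpace ℝ (Fin n)) R,
                  ∫⁻ y in ball (0 : EuclideanSpace ℝ (Fin n)) R,
                    ENNReal.ofReal (|f x - f y| ^ p / ‖x - y‖ ^ ((n : ℝ) + s * p)))
              (nhdsWithin 1 (Set.Iio 1)) := by
  obtain ⟨C, hC, hex⟩ := exists_weak_gradient_of_measurable n hp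
  refine ⟨C, hC, fun R _ f hf hL => ?_⟩
  have hfm := hf.aestronglyMeasurable
  have hff := hfm.ae_eq_mk
  have hE : ∀ β, gagliardoEnergy (ball 0 R) f p β = gagliardoEnergy (ball 0 R) (hfm.mk f) p β :=
    gagliardoEnergy_congr hff p
  simp only [gagliardoEnergy] at hE hex
  simp only [hE] at hL ⊢
  obtain ⟨g, hgm, hg, hgle⟩ := hex R (hfm.mk f) hfm.stronglyMeasurable_mk.measurable
    (LocallyIntegrableOn.congr_ae hf hff) hL
  refine ⟨g, hgm, fun φ hφ hφc hφs v => ?_, ?_⟩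
  · rw [← hg φ hφ hφc hφs v]
    exact integral_congr_ae (hff.mul (ae_eq_refl _))
  · refine le_of_eq_of_le (lintegral_congr fun x => ?_) hgle
    rw [← ENNReal.ofReal_rpow_of_nonneg (norm_nonneg _) (by linarith), ofReal_norm]
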